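/- Let k be a field and A a finitely generated integral k-algebra domain of transcendence degree n over k. The following are equivalent: (1) A admits a positive ℤ-grading over k, and there exists m ∈ ℕ such that the polynomial ring A[x_1, …, x_m] in m variables over A is isomorphic as a k-algebra to the polynomial ring in n + m variables over k; (2) A is isomorphic as a k-algebra to the polynomial ring in n variables over k. -/

import Mathlib

set_option synthInstance.maxHeartbeats 1000000
set_option maxHeartbeats 1000000

/-- `A` admits a positive ℤ-grading over `k`: a ℤ-grading `A = ⊕ A_i` by `k`-submodules
with `A_i = 0` for `i < 0` and `A_0 = k`. -/
def HasPositiveZGrading (k A : Type*) [CommRing k] [CommRing A] [Algebra k A] : Prop :=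
  ∃ 𝒜 : ℤ → Submodule k A, Nonempty (GradedAlgebra 𝒜) ∧
    (∀ i : ℤ, i < 0 → 𝒜 i = ⊥) ∧ 𝒜 0 = 1

open Submodule

/-- Transport of a graded algebra structure along an algebra isomorphism. -/
theorem nonempty_gradedAlgebra_map_algEquiv {ι R A B : Type*} [DecidableEq ι] [AddMonoid ι]
    [CommRing R] [Ring A] [Algebra R A] [Ring B] [Algebra R B] (e : A ≃ₐ[R] B)
    (𝒜 : ι → Submodule R A) [GradedAlgebra 𝒜] :
    Nonempty (GradedAlgebra fun i => (𝒜 i).map e.toLinearMap) := by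
  have hint := DirectSum.Decomposition.isInternal 𝒜
  rw [DirectSum.isInternal_submodule_iff_iSupIndep_and_iSup_eq_top] at hint
  have hmon : SetLike.GradedMonoid fun i => (𝒜 i).map e.toLinearMap :=
    { one_mem := ⟨1, SetLike.one_mem_graded 𝒜, by simp⟩
      mul_mem := by
        rintro i j _ _ ⟨x, hx, rfl⟩ ⟨y, hy, rfl⟩
        exact ⟨x * y, SetLike.mul_mem_graded hx hy, by simp⟩ }
  refine ⟨DirectSum.IsInternal.gradedAlgebra ?_⟩
  rw [DirectSum.isInternal_submodule_iff_iSupIndep_and_iSup_eq_top]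
  refine ⟨hint.1.map_orderIso (Submodule.orderIsoMapComap e.toLinearEquiv), ?_⟩
  rw [← Submodule.map_iSup, hint.2, Submodule.map_top, LinearMap.range_eq_top]
  exact e.surjective

theorem hasPositiveZGrading_mvPolynomial (k σ : Type*) [CommRing k] :
    HasPositiveZGrading k (MvPolynomial σ k) := by
  have hw (d : σ →₀ ℕ) : Finsupp.weight (fun _ : σ => (1 : ℤ)) d = (d.degree : ℤ) := by
    simp [Finsupp.weight_apply, Finsupp.degree_apply, Finsupp.sum]
  refine ⟨MvPolynomial.weightedHomogeneousSubmodule k fun _ => (1 : ℤ),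
    ⟨MvPolynomial.weightedGradedAlgebra k _⟩, fun i hi => ?_, le_antisymm (fun p hp => ?_) ?_⟩
  · refine (Submodule.eq_bot_iff _).2 fun p hp => MvPolynomial.ext _ _ fun d => ?_
    by_contra hd
    have := hp hd
    rw [hw] at this
    omega
  · classical
    rw [Submodule.mem_one]
    refine ⟨p.coeff 0, MvPolynomial.ext _ _ fun d => ?_⟩
    rw [MvPolynomial.algebraMap_eq, MvPolynomial.coeff_C]
    split_ifs with hd
    · rw [hd]
    · by_contra hp'
      have := hp (Ne.symm hp')
      rw [hw] at this
      exact hd ((Finsupp.degree_eq_zero_iff d).1 (by omega)).symm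
  · rw [Submodule.one_le]
    exact MvPolynomial.isWeightedHomogeneous_one _ _

theorem HasPositiveZGrading.of_algEquiv {k A B : Type*} [CommRing k] [CommRing A] [CommRing B]
    [Algebra k A] [Algebra k B] (e : A ≃ₐ[k] B) (h : HasPositiveZGrading k A) :
    HasPositiveZGrading k B := by
  obtain ⟨𝒜, ⟨_⟩, hneg, hzero⟩ := h
  refine ⟨fun i => (𝒜 i).map e.toLinearMap, nonempty_gradedAlgebra_map_algEquiv e 𝒜,
    fun i hi => by simp [hneg i hi], ?_⟩
  simpa [hzero] using Submodule.map_one (e : A →ₐ[k] B)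

/-- A point derivation of a polynomial ring is determined by its values on the variables. -/
theorem MvPolynomial.range_le_span_of_leibniz {σ k V : Type*} [CommRing k] [AddCommGroup V]
    [Module k V] (ε : MvPolynomial σ k →ₐ[k] k) (D : MvPolynomial σ k →ₗ[k] V) (h1 : D 1 = 0)
    (hD : ∀ f g, D (f * g) = ε f • D g + ε g • D f) :
    LinearMap.range D ≤ span k (Set.range fun i => D (X i)) := by
  rintro _ ⟨p, rfl⟩
  induction p using MvPolynomial.induction_on with
  | C a =>
    rw [C_eq_smul_one, map_smul, h1, smul_zero]
    exact zero_mem _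
  | add p q hp hq => rw [map_add]; exact add_mem hp hq
  | mul_X p i hp =>
    rw [hD]
    exact add_mem (smul_mem _ _ (subset_span ⟨i, rfl⟩)) (smul_mem _ _ hp)

/-- The constants and decomposable elements of an augmented algebra. The quotient by this subspace
is the cotangent space at the augmentation. -/
def constAddDecomposable {k A : Type*} [CommRing k] [CommRing A] [Algebra k A] (ε : A →ₐ[k] k) :
    Submodule k A :=
  1 ⊔ LinearMap.ker ε.toLinearMap * LinearMap.ker ε.toLinearMap

theorem mkQ_constAddDecomposable_mul {k A : Type*} [CommRing k] [CommRing A] [Algebra k A]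
    (ε : A →ₐ[k] k) (a b : A) :
    (constAddDecomposable ε).mkQ (a * b) =
      ε a • (constAddDecomposable ε).mkQ b + ε b • (constAddDecomposable ε).mkQ a := by
  rw [← map_smul, ← map_smul, ← map_add, ← sub_eq_zero, ← map_sub, mkQ_apply,
    Submodule.Quotient.mk_eq_zero]
  have hker (c : A) : c - algebraMap k A (ε c) ∈ LinearMap.ker ε.toLinearMap := by simp
  have h : a * b - (ε a • b + ε b • a) =
      -algebraMap k A (ε a * ε b) +
        (a - algebraMap k A (ε a)) * (b - algebraMap k A (ε b)) := by
    simp only [Algebra.smul_def, map_mul]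
    ring
  rw [h]
  exact Submodule.add_mem_sup (neg_mem (Submodule.algebraMap_mem _))
    (Submodule.mul_mem_mul (hker a) (hker b))

/-- The cotangent space of a stably polynomial augmented algebra has at most the expected
dimension. -/
theorem finrank_cotangent_le_of_stably_polynomial {k A : Type*} [Field k] [CommRing A]
    [Algebra k A] (ε : A →ₐ[k] k) {n m : ℕ}
    (e : MvPolynomial (Fin m) A ≃ₐ[k] MvPolynomial (Fin (n + m)) k) :
    Module.Finite k (A ⧸ constAddDecomposable ε) ∧
      Module.finrank k (A ⧸ constAddDecomposable ε) ≤ n := by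
  set δ := (constAddDecomposable ε).mkQ
  have hδ1 : δ 1 = 0 :=
    (Submodule.Quotient.mk_eq_zero _).2 (Submodule.mem_sup_left (Submodule.one_le.1 le_rfl))
  let c : MvPolynomial (Fin m) A →ₐ[k] A :=
    (MvPolynomial.aeval (R := A) (fun _ : Fin m => (0 : A))).restrictScalars k
  let D : MvPolynomial (Fin m) A →ₗ[k] (A ⧸ constAddDecomposable ε) × (Fin m → k) :=
    (δ ∘ₗ c.toLinearMap).prod
      (LinearMap.pi fun i =>
        ε.toLinearMap ∘ₗ c.toLinearMap ∘ₗ (MvPolynomial.pderiv i).toLinearMap.restrictScalars k)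
  have hDapp (f) : D f = (δ (c f), fun i => ε (c (MvPolynomial.pderiv i f))) := rfl
  have hcC (a : A) : c (MvPolynomial.C a) = a := by simp [c]
  have hcX (i) : c (MvPolynomial.X i) = 0 := by simp [c]
  have hD1 : D 1 = 0 := by
    rw [hDapp, map_one, hδ1]
    ext <;> simp
  have hDmul (f g) : D (f * g) = ε (c f) • D g + ε (c g) • D f := by
    simp only [hDapp]
    ext i
    · rw [map_mul]
      exact mkQ_constAddDecomposable_mul ε (c f) (c g)
    · simp [Derivation.leibniz]
  have hsurj : LinearMap.range D = ⊤ := by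
    rw [eq_top_iff]
    rintro ⟨v, u⟩ -
    obtain ⟨a, rfl⟩ := (constAddDecomposable ε).mkQ_surjective v
    refine ⟨MvPolynomial.C a + ∑ i, MvPolynomial.C (algebraMap k A (u i)) * MvPolynomial.X i, ?_⟩
    rw [hDapp]
    ext i
    · simp [hcC, hcX, δ]
    · simp [hcC, MvPolynomial.pderiv_X, Pi.single_apply, Derivation.leibniz]
  have hspan := MvPolynomial.range_le_span_of_leibniz
    ((ε.comp c).comp (e.symm : MvPolynomial (Fin (n + m)) k →ₐ[k] _))
    (D ∘ₗ e.symm.toLinearMap) (by simpa using hD1) (fun f g => by simpa using hDmul _ _)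
  rw [LinearMap.range_comp, LinearMap.range_eq_top.2 e.symm.surjective, Submodule.map_top, hsurj,
    top_le_iff] at hspan
  have hfin : Module.Finite k ((A ⧸ constAddDecomposable ε) × (Fin m → k)) :=
    ⟨hspan ▸ Submodule.fg_span (Set.finite_range _)⟩
  have hfin' : Module.Finite k (A ⧸ constAddDecomposable ε) :=
    Module.Finite.of_surjective (LinearMap.fst k _ (Fin m → k)) Prod.fst_surjective
  refine ⟨hfin', ?_⟩
  have hle := finrank_range_le_card (R := k)
    (fun i => (D ∘ₗ e.symm.toLinearMap) (MvPolynomial.X i))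
  rw [Set.finrank, hspan, finrank_top, Module.finrank_prod, Module.finrank_fin_fun,
    Fintype.card_fin] at hle
  omega

section PositiveGrading

variable {k A : Type*} [Field k] [CommRing A] [Algebra k A] (𝒜 : ℤ → Submodule k A)
  [GradedAlgebra 𝒜]

theorem GradedAlgebra.proj_zero_mul (hneg : ∀ i : ℤ, i < 0 → 𝒜 i = ⊥) (a b : A) :
    GradedAlgebra.proj 𝒜 0 (a * b) = GradedAlgebra.proj 𝒜 0 a * GradedAlgebra.proj 𝒜 0 b := by
  induction a using DirectSum.Decomposition.inductionOn 𝒜 with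
  | zero => simp
  | add a a' ha ha' => simp only [add_mul, map_add, ha, ha']
  | @homogeneous i a =>
    induction b using DirectSum.Decomposition.inductionOn 𝒜 with
    | zero => simp
    | add b b' hb hb' => simp only [mul_add, map_add, hb, hb']
    | @homogeneous j b =>
      obtain ⟨a, ha⟩ := a
      obtain ⟨b, hb⟩ := b
      simp only [GradedAlgebra.proj_apply]
      rcases lt_or_ge i 0 with hi | hi
      · rw [hneg i hi, Submodule.mem_bot] at ha
        simp [ha]
      rcases lt_or_ge j 0 with hj | hj
      · rw [hneg j hj, Submodule.mem_bot] at hb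
        simp [hb]
      have hab := SetLike.mul_mem_graded ha hb
      by_cases hi0 : i = 0
      · subst hi0
        by_cases hj0 : j = 0
        · subst hj0
          rw [add_zero] at hab
          rw [DirectSum.decompose_of_mem_same 𝒜 hab, DirectSum.decompose_of_mem_same 𝒜 ha,
            DirectSum.decompose_of_mem_same 𝒜 hb]
        · rw [DirectSum.decompose_of_mem_ne 𝒜 hab (by omega),
            DirectSum.decompose_of_mem_ne 𝒜 hb hj0, mul_zero]
      · rw [DirectSum.decompose_of_mem_ne 𝒜 hab (by omega),
          DirectSum.decompose_of_mem_ne 𝒜 ha hi0, zero_mul]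

/-- A positively graded algebra is augmented, with augmentation the projection to degree zero. -/
theorem GradedAlgebra.exists_augmentation [Nontrivial A] (hneg : ∀ i : ℤ, i < 0 → 𝒜 i = ⊥)
    (hzero : 𝒜 0 = 1) :
    ∃ ε : A →ₐ[k] k, ∀ a, algebraMap k A (ε a) = GradedAlgebra.proj 𝒜 0 a := by
  let p : A →ₐ[k] A := AlgHom.ofLinearMap (GradedAlgebra.proj 𝒜 0)
    (DirectSum.decompose_of_mem_same 𝒜 SetLike.GradedOne.one_mem)
    (GradedAlgebra.proj_zero_mul 𝒜 hneg)
  have hp (a : A) : p a ∈ (⊥ : Subalgebra k A) := by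
    rw [Algebra.mem_bot, Set.mem_range, ← Submodule.mem_one, ← hzero]
    exact SetLike.coe_mem (DirectSum.decompose 𝒜 a 0)
  refine ⟨(Algebra.botEquiv k A : _ →ₐ[k] k).comp (p.codRestrict ⊥ hp), fun a => ?_⟩
  have h := (Algebra.botEquiv k A).symm_apply_apply (p.codRestrict ⊥ hp a)
  exact congrArg Subtype.val h

/-- The augmentation ideal is spanned by the homogeneous elements of positive degree. -/
theorem GradedAlgebra.ker_augmentation_eq_span (hneg : ∀ i : ℤ, i < 0 → 𝒜 i = ⊥)
    (ε : A →ₐ[k] k) (hε : ∀ a, algebraMap k A (ε a) = GradedAlgebra.proj 𝒜 0 a) :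
    LinearMap.ker ε.toLinearMap ≤ span k {x | ∃ i : ℤ, 0 < i ∧ x ∈ 𝒜 i} := by
  have key (a : A) : a - GradedAlgebra.proj 𝒜 0 a ∈ span k {x | ∃ i : ℤ, 0 < i ∧ x ∈ 𝒜 i} := by
    induction a using DirectSum.Decomposition.inductionOn 𝒜 with
    | zero => simp
    | add a b ha hb =>
      rw [map_add, add_sub_add_comm]
      exact add_mem ha hb
    | @homogeneous i a =>
      obtain ⟨a, ha⟩ := a
      rw [GradedAlgebra.proj_apply]
      rcases lt_trichotomy i 0 with hi | rfl | hi
      · rw [hneg i hi, Submodule.mem_bot] at ha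
        simp [ha]
      · rw [DirectSum.decompose_of_mem_same 𝒜 ha, sub_self]
        exact zero_mem _
      · rw [DirectSum.decompose_of_mem_ne 𝒜 ha hi.ne', sub_zero]
        exact subset_span ⟨i, hi, ha⟩
  intro a ha
  have h := key a
  rwa [← hε, show ε a = 0 from ha, map_zero, sub_zero] at h

/-- Graded Nakayama: homogeneous elements of positive degree spanning the cotangent space generate
a positively graded algebra. -/
theorem GradedAlgebra.adjoin_eq_top_of_span_eq_top (hneg : ∀ i : ℤ, i < 0 → 𝒜 i = ⊥)
    (hzero : 𝒜 0 = 1) (ε : A →ₐ[k] k)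
    (hε : ∀ a, algebraMap k A (ε a) = GradedAlgebra.proj 𝒜 0 a) {ι : Type*} (s : ι → A)
    (hs : ∀ j, ∃ i : ℤ, 0 < i ∧ s j ∈ 𝒜 i)
    (hspan : span k (Set.range fun j => (constAddDecomposable ε).mkQ (s j)) = ⊤) :
    Algebra.adjoin k (Set.range s) = ⊤ := by
  set S := Algebra.adjoin k (Set.range s)
  have htop : span k (Set.range s) ⊔ constAddDecomposable ε = ⊤ := by
    have h : (span k (Set.range s)).map (constAddDecomposable ε).mkQ = ⊤ := by
      rw [Submodule.map_span, ← Set.range_comp]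
      exact hspan
    rw [sup_comm, ← Submodule.comap_map_mkQ, h, Submodule.comap_top]
  have hone : (1 : Submodule k A) ≤ Subalgebra.toSubmodule S := Submodule.one_le.2 (one_mem S)
  have key (d : ℕ) : 𝒜 d ≤ Subalgebra.toSubmodule S := by
    induction d using Nat.strong_induction_on with
    | _ d ih =>
    rcases Nat.eq_zero_or_pos d with rfl | hd
    · rw [Nat.cast_zero, hzero]
      exact hone
    have hprod : (⊤ : Submodule k A) ≤
        (Subalgebra.toSubmodule S).comap (GradedAlgebra.proj 𝒜 (d : ℤ)) := by
      rw [← htop, constAddDecomposable]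
      refine sup_le (span_le.2 ?_) (sup_le ?_ ?_)
      · rintro _ ⟨j, rfl⟩
        obtain ⟨i, -, hi⟩ := hs j
        change GradedAlgebra.proj 𝒜 (d : ℤ) (s j) ∈ S
        rw [GradedAlgebra.proj_apply]
        by_cases hid : i = d
        · subst hid
          rw [DirectSum.decompose_of_mem_same 𝒜 hi]
          exact Algebra.subset_adjoin ⟨j, rfl⟩
        · rw [DirectSum.decompose_of_mem_ne 𝒜 hi hid]
          exact zero_mem S
      · intro x hx
        rw [← hzero] at hx
        change GradedAlgebra.proj 𝒜 (d : ℤ) x ∈ S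
        rw [GradedAlgebra.proj_apply, DirectSum.decompose_of_mem_ne 𝒜 hx (by omega)]
        exact zero_mem S
      · have hker := GradedAlgebra.ker_augmentation_eq_span 𝒜 hneg ε hε
        refine (mul_le_mul' hker hker).trans ?_
        rw [Submodule.span_mul_span, span_le]
        rintro _ ⟨x, ⟨i, hi, hx⟩, y, ⟨j, hj, hy⟩, rfl⟩
        change GradedAlgebra.proj 𝒜 (d : ℤ) (x * y) ∈ S
        have hxy := SetLike.mul_mem_graded hx hy
        rw [GradedAlgebra.proj_apply]
        by_cases hd' : i + j = d
        · rw [hd'] at hxy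
          rw [DirectSum.decompose_of_mem_same 𝒜 hxy]
          lift i to ℕ using hi.le
          lift j to ℕ using hj.le
          exact mul_mem (ih i (by omega) hx) (ih j (by omega) hy)
        · rw [DirectSum.decompose_of_mem_ne 𝒜 hxy hd']
          exact zero_mem S
    intro x hx
    have h : GradedAlgebra.proj 𝒜 (d : ℤ) x ∈ S := hprod (Submodule.mem_top (x := x))
    rwa [GradedAlgebra.proj_apply, DirectSum.decompose_of_mem_same 𝒜 hx] at h
  rw [eq_top_iff]
  rintro a -
  induction a using DirectSum.Decomposition.inductionOn 𝒜 with
  | zero => exact zero_mem S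
  | add a b ha hb => exact add_mem ha hb
  | @homogeneous i a =>
    rcases lt_or_ge i 0 with hi | hi
    · have ha : (a : A) = 0 := (Submodule.mem_bot k).1 (hneg i hi ▸ a.2)
      exact ha ▸ zero_mem S
    · lift i to ℕ using hi
      exact key i a.2

theorem GradedAlgebra.exists_generators (hneg : ∀ i : ℤ, i < 0 → 𝒜 i = ⊥)
    (hzero : 𝒜 0 = 1) (ε : A →ₐ[k] k)
    (hε : ∀ a, algebraMap k A (ε a) = GradedAlgebra.proj 𝒜 0 a)
    [Module.Finite k (A ⧸ constAddDecomposable ε)] :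
    ∃ s : Fin (Module.finrank k (A ⧸ constAddDecomposable ε)) → A,
      Algebra.adjoin k (Set.range s) = ⊤ := by
  set H : Set A := {x | ∃ i : ℤ, 0 < i ∧ x ∈ 𝒜 i}
  have hH : span k ((constAddDecomposable ε).mkQ '' H) = ⊤ := by
    rw [← Submodule.map_span, eq_top_iff]
    rintro v -
    obtain ⟨a, rfl⟩ := (constAddDecomposable ε).mkQ_surjective v
    refine ⟨a - algebraMap k A (ε a),
      GradedAlgebra.ker_augmentation_eq_span 𝒜 hneg ε hε (by simp), ?_⟩
    rw [map_sub, sub_eq_self, mkQ_apply, Submodule.Quotient.mk_eq_zero]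
    exact Submodule.mem_sup_left (Submodule.algebraMap_mem _)
  obtain ⟨f, hf, hfspan, -⟩ :=
    Submodule.exists_fun_fin_finrank_span_eq k ((constAddDecomposable ε).mkQ '' H)
  replace hfspan := hfspan.trans hH
  choose s hs hsf using hf
  have hr : Module.finrank k (A ⧸ constAddDecomposable ε) =
      Module.finrank k (span k ((constAddDecomposable ε).mkQ '' H)) := by
    rw [hH, finrank_top]
  rw [hr]
  refine ⟨s, GradedAlgebra.adjoin_eq_top_of_span_eq_top 𝒜 hneg hzero ε hε s hs ?_⟩
  simpa only [hsf] using hfspan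

end PositiveGrading

/-- An algebra generated by at most as many elements as some algebraically independent family has
is a polynomial ring. -/
theorem nonempty_algEquiv_mvPolynomial_of_adjoin_eq_top {k A : Type*} [Field k] [CommRing A]
    [IsDomain A] [Algebra k A] {n r : ℕ} (hr : r ≤ n) {x : Fin n → A}
    (hx : AlgebraicIndependent k x) {s : Fin r → A} (hs : Algebra.adjoin k (Set.range s) = ⊤) :
    Nonempty (A ≃ₐ[k] MvPolynomial (Fin n) k) := by
  have halg : Algebra.IsAlgebraic (Algebra.adjoin k (Set.range s)) A :=
    ⟨fun a => isAlgebraic_algebraMap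
      (⟨a, hs ▸ Algebra.mem_top⟩ : Algebra.adjoin k (Set.range s))⟩
  have hn : (n : Cardinal) ≤ Algebra.trdeg k A := by
    simpa using hx.lift_cardinalMk_le_trdeg
  have hr' : Algebra.trdeg k A ≤ r := by
    have h := Algebra.IsAlgebraic.trdeg_le_cardinalMk k (Set.range s)
    have h' := Cardinal.mk_range_le_lift (f := s)
    simp only [Cardinal.lift_id', Cardinal.mk_fin, Cardinal.lift_natCast] at h'
    exact h.trans h'
  obtain rfl : r = n := le_antisymm hr (by exact_mod_cast hn.trans hr')
  have hb := Algebra.IsAlgebraic.isTranscendenceBasis_of_lift_le_trdeg_of_finite k s (by simpa)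
  exact ⟨((hb.1.aevalEquiv.trans (Subalgebra.equivOfEq _ _ hs)).trans Subalgebra.topEquiv).symm⟩

/-- Let `k` be a field and `A` a finitely generated integral `k`-algebra
domain of transcendence degree `n` over `k`.  The following are equivalent:
(1) `A` admits a positive ℤ-grading over `k`, and there exists `m ∈ ℕ` such that the
polynomial ring `A[x_1, …, x_m]` is isomorphic as a `k`-algebra to the polynomial ring
in `n + m` variables over `k`;
(2) `A` is isomorphic as a `k`-algebra to the polynomial ring in `n` variables over `k`.
-/
theorem stmt_19 {k A : Type*} [Field k] [CommRing A] [IsDomain A] [Algebra k A]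
    (hfg : Algebra.FiniteType k A) (n : ℕ)
    (htr1 : ∃ s : Fin n → A, AlgebraicIndependent k s)
    (htr2 : ∀ t : Fin (n + 1) → A, ¬ AlgebraicIndependent k t) :
    (HasPositiveZGrading k A ∧
        ∃ m : ℕ, Nonempty (MvPolynomial (Fin m) A ≃ₐ[k] MvPolynomial (Fin (n + m)) k)) ↔
      Nonempty (A ≃ₐ[k] MvPolynomial (Fin n) k) := by
  constructor
  · rintro ⟨⟨𝒜, ⟨_⟩, hneg, hzero⟩, m, ⟨e⟩⟩
    obtain ⟨x, hx⟩ := htr1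
    obtain ⟨ε, hε⟩ := GradedAlgebra.exists_augmentation 𝒜 hneg hzero
    obtain ⟨_, hle⟩ := finrank_cotangent_le_of_stably_polynomial ε e
    obtain ⟨s, hs⟩ := GradedAlgebra.exists_generators 𝒜 hneg hzero ε hε
    exact nonempty_algEquiv_mvPolynomial_of_adjoin_eq_top hle hx hs
  · rintro ⟨e⟩
    exact ⟨(hasPositiveZGrading_mvPolynomial k (Fin n)).of_algEquiv e.symm, 0,
      ⟨((MvPolynomial.isEmptyAlgEquiv A (Fin 0)).restrictScalars k).trans e⟩⟩
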